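/- Let C be a nontrivial cyclic linear code of length n over GF(q), and let C̄ be its extended code of length n + 1. If d(C̄) = d(C) + 1, then the dual code (C̄)⊥ has minimum linear locality d(C). -/

import Mathlib

open scoped BigOperators

variable {F : Type*} [Field F] {ι : Type*} [Fintype ι]

/-- The Hamming weight of a word: the number of nonzero coordinates. -/
noncomputable def wt (c : ι → F) : ℕ := {i | c i ≠ 0}.ncard

/-- The minimum distance of a linear code: the least Hamming weight of a nonzero codeword. -/
noncomputable def minDist (C : Submodule F (ι → F)) : ℕ :=
  sInf {w | ∃ c ∈ C, c ≠ 0 ∧ wt c = w}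

/-- The dual code of a linear code. -/
def dualCode (C : Submodule F (ι → F)) : Submodule F (ι → F) where
  carrier := {x | ∀ c ∈ C, ∑ i, x i * c i = 0}
  add_mem' := by
    intro a b ha hb c hc
    have h1 := ha c hc
    have h2 := hb c hc
    simp only [Set.mem_setOf_eq, Pi.add_apply, add_mul, Finset.sum_add_distrib, h1, h2, add_zero]
  zero_mem' := by intro c hc; simp
  smul_mem' := by
    intro r a ha c hc
    have h := ha c hc
    simp only [Set.mem_setOf_eq, Pi.smul_apply, smul_eq_mul, mul_assoc, ← Finset.mul_sum, h,
      mul_zero]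

/-- `C` has linear locality `r`: every code symbol `c i` is a fixed linear combination of
at most `r` other code symbols. -/
def HasLinearLocality (C : Submodule F (ι → F)) (r : ℕ) : Prop :=
  ∀ i : ι, ∃ (R : Finset ι) (u : ι → F), i ∉ R ∧ R.card ≤ r ∧
    ∀ c ∈ C, c i = ∑ j ∈ R, u j * c j

/-- The extended code of a code of length `n`: append an overall parity-check coordinate. -/
def extendedCode {n : ℕ} (C : Submodule F (Fin n → F)) : Submodule F (Fin (n + 1) → F) where
  carrier := {x | (fun i : Fin n => x i.castSucc) ∈ C ∧ ∑ i, x i = 0}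
  add_mem' := by
    rintro a b ⟨ha1, ha2⟩ ⟨hb1, hb2⟩
    exact ⟨C.add_mem ha1 hb1, by simp [Finset.sum_add_distrib, ha2, hb2]⟩
  zero_mem' := ⟨C.zero_mem, by simp⟩
  smul_mem' := by
    rintro r a ⟨ha1, ha2⟩
    exact ⟨C.smul_mem r ha1, by
      simp only [Pi.smul_apply, smul_eq_mul, ← Finset.mul_sum, ha2, mul_zero]⟩

theorem minDist_le_wt {C : Submodule F (ι → F)} {c : ι → F} (hc : c ∈ C) (h0 : c ≠ 0) :
    minDist C ≤ wt c :=
  Nat.sInf_le ⟨c, hc, h0, rfl⟩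

theorem exists_wt_eq_minDist {C : Submodule F (ι → F)} (h : minDist C ≠ 0) :
    ∃ c ∈ C, c ≠ 0 ∧ wt c = minDist C :=
  Nat.sInf_mem (s := {w | ∃ c ∈ C, c ≠ 0 ∧ wt c = w})
    (Nat.nonempty_of_pos_sInf (Nat.pos_of_ne_zero h))

theorem wt_comp_equiv (e : ι ≃ ι) (c : ι → F) : wt (c ∘ e) = wt c := by
  have : {i | c i ≠ 0} = e '' {i | (c ∘ e) i ≠ 0} := by
    rw [Equiv.image_eq_preimage_symm]
    ext i
    simp
  rw [wt, wt, this, Set.ncard_image_of_injective _ e.injective]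

/-- A code contains its double dual. -/
theorem dualCode_dualCode_le (C : Submodule F (ι → F)) : dualCode (dualCode C) ≤ C := by
  classical
  intro w hw
  by_contra hwC
  obtain ⟨f, hfw, hf⟩ := Submodule.exists_le_ker_of_notMem hwC
  have key (v : ι → F) : f v = ∑ i, f (Pi.single i 1) * v i := by
    rw [LinearMap.pi_apply_eq_sum_univ f v]
    refine Finset.sum_congr rfl fun i _ => ?_
    rw [smul_eq_mul, mul_comm]
    congr 2
    ext j
    simp [Pi.single_apply, eq_comm]
  refine hfw ?_
  rw [key, ← hw (fun i => f (Pi.single i 1)) fun c hc => by rw [← key]; exact hf hc]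
  exact Finset.sum_congr rfl fun i _ => mul_comm _ _

/-- If every coordinate lies in the support of a codeword of weight at most `r + 1`,
then the dual code has linear locality `r`. -/
theorem hasLinearLocality_dualCode {C : Submodule F (ι → F)} {r : ℕ}
    (h : ∀ i, ∃ c ∈ C, c i ≠ 0 ∧ wt c ≤ r + 1) : HasLinearLocality (dualCode C) r := by
  classical
  intro i
  obtain ⟨c, hc, hci, hw⟩ := h i
  have hcard : wt c = (Finset.univ.filter fun j => c j ≠ 0).card := by
    rw [wt, ← Set.ncard_coe_finset]
    simp
  have hi : i ∈ Finset.univ.filter fun j => c j ≠ 0 := by simpa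
  refine ⟨(Finset.univ.filter fun j => c j ≠ 0).erase i, fun j => -(c j / c i),
    Finset.notMem_erase _ _, ?_, fun x hx => ?_⟩
  · rw [Finset.card_erase_of_mem hi]
    omega
  · have hsum : ∑ j ∈ Finset.univ.filter (fun j => c j ≠ 0), x j * c j = 0 := by
      refine (Finset.sum_subset (Finset.filter_subset _ _) fun j _ hj => ?_).trans (hx c hc)
      rw [show c j = 0 by simpa using hj, mul_zero]
    rw [← Finset.add_sum_erase _ _ hi] at hsum
    have hterm : ∀ j, -(c j / c i) * x j = -(x j * c j) / c i := fun j => by ring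
    simp_rw [hterm]
    rw [← Finset.sum_div, Finset.sum_neg_distrib, eq_div_iff hci]
    linear_combination hsum

/-- A linear locality of the dual code bounds the minimum distance from above. -/
theorem minDist_le_of_hasLinearLocality [Nonempty ι] {C : Submodule F (ι → F)} {r : ℕ}
    (h : HasLinearLocality (dualCode C) r) : minDist C ≤ r + 1 := by
  classical
  obtain ⟨i⟩ := ‹Nonempty ι›
  obtain ⟨R, u, hiR, hR, hu⟩ := h i
  let w : ι → F := fun j => (if j = i then 1 else 0) - if j ∈ R then u j else 0
  have hwi : w i = 1 := by simp [w, hiR]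
  have hwC : w ∈ C := dualCode_dualCode_le C fun x hx => by
    have := hu x hx
    simp [w, sub_mul, ite_mul, Finset.sum_sub_distrib, this]
  refine (minDist_le_wt hwC fun h0 => by simp [h0] at hwi).trans ?_
  have hsub : {j | w j ≠ 0} ⊆ (insert i R : Finset ι) := fun j hj => by
    by_contra hj'
    simp only [Finset.coe_insert, Set.mem_insert_iff, Finset.mem_coe, not_or] at hj'
    exact hj (by simp [w, hj'])
  calc wt w ≤ (insert i R).card := by
        rw [← Set.ncard_coe_finset]
        exact Set.ncard_le_ncard hsub (Finset.finite_toSet _)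
    _ ≤ r + 1 := (Finset.card_insert_le _ _).trans (by omega)

theorem shift_mem_of_cyclic {n : ℕ} [NeZero n] {C : Submodule F (Fin n → F)}
    (hcyc : ∀ c ∈ C, (fun i : Fin n => c (i - 1)) ∈ C) {c : Fin n → F} (hc : c ∈ C)
    (a : Fin n) : (fun i => c (i - a)) ∈ C := by
  have key (k : ℕ) : (fun i : Fin n => c (i - k • 1)) ∈ C := by
    induction k with
    | zero => simpa using hc
    | succ k ih =>
      convert hcyc _ ih using 3
      rw [succ_nsmul, sub_add_eq_sub_sub_swap]
  have ha : a = a.val • (1 : Fin n) := by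
    open scoped Fin.CommRing in
    rw [nsmul_one, Fin.cast_val_eq_self]
  rw [ha]
  exact key _

/-- The extension of a word by an overall parity check. -/
def parityExtend {n : ℕ} (c : Fin n → F) : Fin (n + 1) → F :=
  Fin.snoc (α := fun _ => F) c (-∑ i, c i)

theorem parityExtend_castSucc {n : ℕ} (c : Fin n → F) (i : Fin n) :
    parityExtend c i.castSucc = c i := by
  simp [parityExtend]

theorem parityExtend_mem {n : ℕ} {C : Submodule F (Fin n → F)} {c : Fin n → F} (hc : c ∈ C) :
    parityExtend c ∈ extendedCode C :=
  ⟨by simpa [parityExtend_castSucc] using hc, by simp [Fin.sum_univ_castSucc, parityExtend]⟩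

theorem wt_eq_wt_castSucc {n : ℕ} {x : Fin (n + 1) → F} (h : x (Fin.last n) = 0) :
    wt x = wt fun i : Fin n => x i.castSucc := by
  have : {i | x i ≠ 0} = Fin.castSucc '' {i : Fin n | x i.castSucc ≠ 0} := by
    ext i
    cases i using Fin.lastCases <;> simp [h, Fin.castSucc_ne_last]
  rw [wt, wt, this, Set.ncard_image_of_injective _ (Fin.castSucc_injective n)]

theorem wt_le_wt_castSucc_add_one {n : ℕ} (x : Fin (n + 1) → F) :
    wt x ≤ (wt fun i : Fin n => x i.castSucc) + 1 := by
  have : {i | x i ≠ 0} ⊆ insert (Fin.last n) (Fin.castSucc '' {i : Fin n | x i.castSucc ≠ 0}) := by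
    intro i hi
    cases i using Fin.lastCases <;> simp_all
  rw [wt, wt, ← Set.ncard_image_of_injective _ (Fin.castSucc_injective n)]
  exact (Set.ncard_le_ncard this (Set.toFinite _)).trans (Set.ncard_insert_le _ _)

/-- Let `C` be a nontrivial cyclic code. If `d(C̄) = d(C) + 1`, then the dual
of the extended code `C̄` has minimum linear locality `d(C)`. -/
theorem statement6 {n : ℕ} [NeZero n] (C : Submodule F (Fin n → F))
    (hcyc : ∀ c ∈ C, (fun i : Fin n => c (i - 1)) ∈ C)
    (h1 : 2 ≤ minDist C) (h2 : 2 ≤ minDist (dualCode C))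
    (hext : minDist (extendedCode C) = minDist C + 1) :
    IsLeast {r : ℕ | HasLinearLocality (dualCode (extendedCode C)) r} (minDist C) := by
  refine ⟨hasLinearLocality_dualCode fun i => ?_, fun r hr => ?_⟩
  · obtain ⟨c, hc, hc0, hcw⟩ := exists_wt_eq_minDist (C := C) (by omega)
    obtain ⟨k, hk⟩ := Function.ne_iff.mp hc0
    have hwt (b : Fin n → F) (hb : wt b = minDist C) : wt (parityExtend b) ≤ minDist C + 1 := by
      simpa [parityExtend_castSucc, hb] using wt_le_wt_castSucc_add_one (parityExtend b)
    cases i using Fin.lastCases with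
    | last =>
      refine ⟨parityExtend c, parityExtend_mem hc, fun hlast => ?_, hwt c hcw⟩
      have hle := minDist_le_wt (parityExtend_mem hc) fun h0 => hk <| by
        rw [← parityExtend_castSucc c k, h0]
        rfl
      rw [wt_eq_wt_castSucc hlast] at hle
      simp only [parityExtend_castSucc] at hle
      change _ ≤ wt c at hle
      omega
    | cast j =>
      refine ⟨parityExtend fun l => c (l - (j - k)),
        parityExtend_mem (shift_mem_of_cyclic hcyc hc _), ?_, hwt _ ?_⟩
      · rw [parityExtend_castSucc, sub_sub_cancel]
        exact hk
      · rw [← hcw]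
        exact wt_comp_equiv (Equiv.subRight (j - k)) c
  · have := minDist_le_of_hasLinearLocality hr
    omega
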